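/- arXiv:1511.04068 — 7 statements merged into one kernel-verified Lean document; each statement's English description precedes it below -/
import Mathlib

section
/- For every natural number n, the number of sequences (s_1, …, s_{3n}) of steps s_r ∈ {(1,−1), (0,1), (−1,0)} ⊆ ℤ² such that every partial sum s_1 + ⋯ + s_r (for 0 ≤ r ≤ 3n) lies in the nonnegative quadrant ℤ_{≥0}² and the total sum s_1 + ⋯ + s_{3n} equals (0,0) is exactly 2·(3n)! / ((n+2)!·(n+1)!·n!). Moreover, for any length ℓ that is not divisible by 3, there are no such sequences of length ℓ. -/
/-- The partial sum of the first `r` steps of a walk `f : Fin ℓ → ℤ × ℤ`. -/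
def partialSum {ℓ : ℕ} (f : Fin ℓ → ℤ × ℤ) (r : ℕ) : ℤ × ℤ :=
  ∑ i ∈ Finset.univ.filter (fun i : Fin ℓ => (i : ℕ) < r), f i

/-- The number of sequences of `ℓ` steps from `{(1,-1), (0,1), (-1,0)}` all of whose
partial sums lie in the nonnegative quadrant and whose total sum is `(0,0)`. -/
noncomputable def quadrantWalkCount (ℓ : ℕ) : ℕ :=
  Nat.card {f : Fin ℓ → ℤ × ℤ //
    (∀ i, f i ∈ ({((1 : ℤ), (-1 : ℤ)), ((0 : ℤ), (1 : ℤ)), ((-1 : ℤ), (0 : ℤ))} :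
        Set (ℤ × ℤ))) ∧
    (∀ r ≤ ℓ, 0 ≤ (partialSum f r).1 ∧ 0 ≤ (partialSum f r).2) ∧
    partialSum f ℓ = (0, 0)}

open Finset

/-- The steps `(1,-1)`, `(0,1)`, `(-1,0)`. -/
def quadrantSteps : Finset (ℤ × ℤ) := {(1, -1), (0, 1), (-1, 0)}

/-- The quadrant walks of length `ℓ` from the origin to `z`, built by appending steps. -/
def quadrantWalks : (ℓ : ℕ) → ℤ × ℤ → Finset (Fin ℓ → ℤ × ℤ)
  | 0, z => if z = 0 then univ else ∅
  | ℓ + 1, z =>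
    if 0 ≤ z.1 ∧ 0 ≤ z.2 then
      quadrantSteps.biUnion fun s =>
        (quadrantWalks ℓ (z - s)).image fun f => Fin.snoc (α := fun _ => ℤ × ℤ) f s
    else ∅

theorem partialSum_length {ℓ : ℕ} (f : Fin ℓ → ℤ × ℤ) : partialSum f ℓ = ∑ i, f i := by
  simp [partialSum]

theorem partialSum_init {ℓ : ℕ} (f : Fin (ℓ + 1) → ℤ × ℤ) {r : ℕ} (hr : r ≤ ℓ) :
    partialSum f r = partialSum (fun i : Fin ℓ => f i.castSucc) r := by
  simp [partialSum, sum_filter, Fin.sum_univ_castSucc, hr.not_gt]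

theorem partialSum_succ_length {ℓ : ℕ} (f : Fin (ℓ + 1) → ℤ × ℤ) :
    partialSum f (ℓ + 1) =
      partialSum (fun i : Fin ℓ => f i.castSucc) ℓ + f (Fin.last ℓ) := by
  simp [partialSum_length, Fin.sum_univ_castSucc]

theorem mem_quadrantWalks {ℓ : ℕ} {z : ℤ × ℤ} {f : Fin ℓ → ℤ × ℤ} :
    f ∈ quadrantWalks ℓ z ↔ (∀ i, f i ∈ quadrantSteps) ∧
      (∀ r ≤ ℓ, 0 ≤ (partialSum f r).1 ∧ 0 ≤ (partialSum f r).2) ∧ partialSum f ℓ = z := by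
  induction ℓ generalizing z with
  | zero =>
    simp only [quadrantWalks, partialSum, univ_eq_empty, filter_empty, sum_empty]
    split_ifs with h
    · simpa [h] using Subsingleton.elim f _
    · simp [eq_comm, h]
  | succ ℓ ih =>
    have key : f ∈ quadrantWalks (ℓ + 1) z ↔ (0 ≤ z.1 ∧ 0 ≤ z.2) ∧
        f (Fin.last ℓ) ∈ quadrantSteps ∧
        (fun i : Fin ℓ => f i.castSucc) ∈ quadrantWalks ℓ (z - f (Fin.last ℓ)) := by
      rw [quadrantWalks]
      split_ifs with h
      · simp only [mem_biUnion, mem_image, h, true_and]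
        constructor
        · rintro ⟨s, hs, g, hg, rfl⟩
          simpa [hs] using hg
        · rintro ⟨hs, hg⟩
          exact ⟨_, hs, _, hg, Fin.snoc_init_self f⟩
      · simp [h]
    rw [key, ih, Fin.forall_fin_succ', partialSum_succ_length, eq_sub_iff_add_eq]
    constructor
    · rintro ⟨hz, hl, hi, hr, he⟩
      refine ⟨⟨hi, hl⟩, fun r h => ?_, he⟩
      rcases h.eq_or_lt with rfl | h
      · rwa [partialSum_succ_length, he]
      · rw [partialSum_init f (by omega)]
        exact hr r (by omega)
    · rintro ⟨⟨hi, hl⟩, hr, he⟩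
      refine ⟨?_, hl, hi, fun r h => ?_, he⟩
      · rw [← he, ← partialSum_succ_length]
        exact hr _ le_rfl
      · rw [← partialSum_init f h]
        exact hr r (by omega)

theorem quadrantWalkCount_eq_card (ℓ : ℕ) :
    quadrantWalkCount ℓ = (quadrantWalks ℓ (0, 0)).card := by
  rw [quadrantWalkCount, ← Nat.card_eq_finsetCard]
  refine Nat.card_congr (Equiv.subtypeEquivRight fun f => ?_)
  simp [mem_quadrantWalks, quadrantSteps]

theorem card_quadrantWalks_succ (ℓ : ℕ) {x y : ℤ} (hx : 0 ≤ x) (hy : 0 ≤ y) :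
    (quadrantWalks (ℓ + 1) (x, y)).card = (quadrantWalks ℓ (x - 1, y + 1)).card +
      (quadrantWalks ℓ (x, y - 1)).card + (quadrantWalks ℓ (x + 1, y)).card := by
  rw [quadrantWalks, if_pos ⟨hx, hy⟩, card_biUnion]
  · have hinj (s : ℤ × ℤ) : Function.Injective
        fun f : Fin ℓ → ℤ × ℤ => Fin.snoc (α := fun _ => ℤ × ℤ) f s :=
      fun _ _ h => (Fin.snoc_injective2 h).1
    simp_rw [card_image_of_injective _ (hinj _)]
    simp [quadrantSteps, add_assoc]
  · intro s _ t _ hst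
    simp only [disjoint_left, mem_image]
    rintro _ ⟨f, _, rfl⟩ ⟨g, _, h⟩
    exact hst (Fin.snoc_injective2 h).2.symm

theorem quadrantWalks_eq_empty {ℓ : ℕ} {x y : ℤ} (h : x < 0 ∨ y < 0) :
    quadrantWalks ℓ (x, y) = ∅ := by
  cases ℓ with
  | zero =>
    rw [quadrantWalks, if_neg]
    rw [Prod.mk_eq_zero]
    omega
  | succ ℓ =>
    rw [quadrantWalks, if_neg]
    dsimp only
    omega

theorem exists_length_eq_of_mem_quadrantWalks {ℓ : ℕ} {x y : ℤ} {f : Fin ℓ → ℤ × ℤ}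
    (hf : f ∈ quadrantWalks ℓ (x, y)) : ∃ c : ℕ, (ℓ : ℤ) = 3 * c + 2 * x + y := by
  induction ℓ generalizing x y with
  | zero =>
    rw [quadrantWalks] at hf
    split_ifs at hf with h
    · obtain ⟨rfl, rfl⟩ := Prod.mk_eq_zero.1 h
      exact ⟨0, by simp⟩
    · simp at hf
  | succ ℓ ih =>
    rw [quadrantWalks] at hf
    split_ifs at hf with h
    · simp only [quadrantSteps, mem_biUnion, mem_image, mem_insert, mem_singleton] at hf
      obtain ⟨s, rfl | rfl | rfl, g, hg, -⟩ := hf <;> obtain ⟨c, hc⟩ := ih hg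
      · exact ⟨c, by push_cast; linarith⟩
      · exact ⟨c, by push_cast; linarith⟩
      · exact ⟨c + 1, by push_cast; linarith⟩
    · simp at hf

/-- Hook length formula for three rows of lengths `b`, `a`, `c`, the numbers of steps `(0,1)`,
`(1,-1)` and `(-1,0)`; it still holds (with both sides zero) one step outside the quadrant. -/
theorem card_quadrantWalks_mul_factorials {ℓ a b c : ℕ} (hℓ : b + a + c = ℓ)
    (hab : a ≤ b + 1) (hca : c ≤ a + 1) :
    ((quadrantWalks ℓ ((a : ℤ) - c, (b : ℤ) - a)).card : ℤ) *
        ((b + 2).factorial * (a + 1).factorial * c.factorial) =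
      ℓ.factorial * (((b : ℤ) - a + 1) * (a - c + 1) * (b - c + 2)) := by
  induction ℓ generalizing a b c with
  | zero =>
    obtain ⟨rfl, rfl, rfl⟩ : a = 0 ∧ b = 0 ∧ c = 0 := by omega
    simp [quadrantWalks]
  | succ ℓ ih =>
    rcases hab.eq_or_lt with rfl | hab
    · rw [quadrantWalks_eq_empty (by push_cast; omega)]
      push_cast; simp
    rcases hca.eq_or_lt with rfl | hca
    · rw [quadrantWalks_eq_empty (by push_cast; omega)]
      push_cast; simp
    rw [card_quadrantWalks_succ _ (by omega) (by omega)]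
    have hB : ((quadrantWalks ℓ ((a : ℤ) - c, (b : ℤ) - a - 1)).card : ℤ) *
        ((b + 2).factorial * (a + 1).factorial * c.factorial) =
        ℓ.factorial * ((b + 2) * (((b : ℤ) - a) * (a - c + 1) * (b - c + 1))) := by
      obtain ⟨b, rfl⟩ : ∃ b', b = b' + 1 := ⟨b - 1, by omega⟩
      have h := ih (a := a) (b := b) (c := c) (by omega) (by omega) (by omega)
      rw [show ((b + 1 : ℕ) : ℤ) - a - 1 = b - a by push_cast; ring,
        Nat.factorial_succ (b + 2)]
      push_cast
      linear_combination ((b : ℤ) + 3) * h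
    have hA : ((quadrantWalks ℓ ((a : ℤ) - c - 1, (b : ℤ) - a + 1)).card : ℤ) *
        ((b + 2).factorial * (a + 1).factorial * c.factorial) =
        ℓ.factorial * ((a + 1) * (((b : ℤ) - a + 2) * (a - c) * (b - c + 2))) := by
      rcases a with _ | a
      · obtain rfl : c = 0 := by omega
        rw [quadrantWalks_eq_empty (by simp)]
        simp
      have h := ih (a := a) (b := b) (c := c) (by omega) (by omega) (by omega)
      rw [show ((a + 1 : ℕ) : ℤ) - c - 1 = a - c by push_cast; ring,
        show (b : ℤ) - (a + 1 : ℕ) + 1 = b - a by push_cast; ring,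
        Nat.factorial_succ (a + 1)]
      push_cast
      linear_combination ((a : ℤ) + 2) * h
    have hC : ((quadrantWalks ℓ ((a : ℤ) - c + 1, (b : ℤ) - a)).card : ℤ) *
        ((b + 2).factorial * (a + 1).factorial * c.factorial) =
        ℓ.factorial * (c * (((b : ℤ) - a + 1) * (a - c + 2) * (b - c + 3))) := by
      rcases c with _ | c
      · rw [eq_empty_of_forall_notMem (s := quadrantWalks ℓ _) fun f hf => ?_]
        · simp
        · obtain ⟨k, hk⟩ := exists_length_eq_of_mem_quadrantWalks hf
          push_cast at hk
          omega
      have h := ih (a := a) (b := b) (c := c) (by omega) (by omega) (by omega)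
      rw [show (a : ℤ) - (c + 1 : ℕ) + 1 = a - c by push_cast; ring, Nat.factorial_succ c]
      push_cast
      linear_combination ((c : ℤ) + 1) * h
    have hl : (ℓ : ℤ) + 1 = b + a + c := by exact_mod_cast hℓ.symm
    rw [Nat.factorial_succ ℓ]
    push_cast
    rw [hl]
    linear_combination hA + hB + hC

theorem quadrant_walk_count_eq_3d_catalan :
    (∀ n : ℕ, quadrantWalkCount (3 * n) =
      2 * Nat.factorial (3 * n) /
        (Nat.factorial (n + 2) * Nat.factorial (n + 1) * Nat.factorial n)) ∧
    ∀ ℓ : ℕ, ¬ (3 ∣ ℓ) → quadrantWalkCount ℓ = 0 := by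
  refine ⟨fun n => ?_, fun ℓ hℓ => ?_⟩
  · have h := card_quadrantWalks_mul_factorials (ℓ := 3 * n) (a := n) (b := n) (c := n)
      (by ring) (by omega) (by omega)
    rw [sub_self, ← quadrantWalkCount_eq_card] at h
    refine (Nat.div_eq_of_eq_mul_left (by positivity) ?_).symm
    zify
    linear_combination -h
  · rw [quadrantWalkCount_eq_card, card_eq_zero]
    refine eq_empty_of_forall_notMem fun f hf => ?_
    obtain ⟨c, hc⟩ := exists_length_eq_of_mem_quadrantWalks hf
    omega
end

section
/- For every natural number n, the number of lattice walks from (0,0,0) to (n,n,n) of length 3n using unit steps (1,0,0), (0,1,0), (0,0,1), all of whose intermediate positions (x,y,z) satisfy y ≥ x ≥ z, equals 2·(3n)! / ((n+2)!·(n+1)!·n!). -/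
/-- The partial sum of the first `r` steps of a walk `f : Fin ℓ → ℤ × ℤ × ℤ`. -/
def partialSum3 {ℓ : ℕ} (f : Fin ℓ → ℤ × ℤ × ℤ) (r : ℕ) : ℤ × ℤ × ℤ :=
  ∑ i ∈ Finset.univ.filter (fun i : Fin ℓ => (i : ℕ) < r), f i

/-- The walks of length `t` from the origin to `p` with unit steps whose positions `(x, y, z)` all
satisfy `z ≤ x ≤ y`. -/
def youngWalks (t : ℕ) (p : ℤ × ℤ × ℤ) : Set (Fin t → ℤ × ℤ × ℤ) :=
  {f | (∀ i, f i ∈ ({((1 : ℤ), (0 : ℤ), (0 : ℤ)), ((0 : ℤ), (1 : ℤ), (0 : ℤ)),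
          ((0 : ℤ), (0 : ℤ), (1 : ℤ))} : Set (ℤ × ℤ × ℤ))) ∧
      (∀ r ≤ t, (partialSum3 f r).1 ≤ (partialSum3 f r).2.1 ∧
        (partialSum3 f r).2.2 ≤ (partialSum3 f r).1) ∧
      partialSum3 f t = p}

theorem partialSum3_snoc_of_le {t : ℕ} (f : Fin t → ℤ × ℤ × ℤ) (s : ℤ × ℤ × ℤ) {r : ℕ}
    (hr : r ≤ t) :
    partialSum3 (Fin.snoc f s : Fin (t + 1) → ℤ × ℤ × ℤ) r = partialSum3 f r := by
  simp [partialSum3, Finset.sum_filter, Fin.sum_univ_castSucc, hr.not_gt]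

theorem partialSum3_snoc_last {t : ℕ} (f : Fin t → ℤ × ℤ × ℤ) (s : ℤ × ℤ × ℤ) :
    partialSum3 (Fin.snoc f s : Fin (t + 1) → ℤ × ℤ × ℤ) (t + 1) = partialSum3 f t + s := by
  simp [partialSum3, Finset.sum_filter, Fin.sum_univ_castSucc]

theorem snoc_mem_youngWalks_iff {t : ℕ} {x y z : ℤ} (hxy : x ≤ y) (hzx : z ≤ x)
    (f : Fin t → ℤ × ℤ × ℤ) (s : ℤ × ℤ × ℤ) :
    (Fin.snoc f s : Fin (t + 1) → ℤ × ℤ × ℤ) ∈ youngWalks (t + 1) (x, y, z) ↔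
      s ∈ ({((1 : ℤ), (0 : ℤ), (0 : ℤ)), ((0 : ℤ), (1 : ℤ), (0 : ℤ)),
          ((0 : ℤ), (0 : ℤ), (1 : ℤ))} : Set (ℤ × ℤ × ℤ)) ∧
        f ∈ youngWalks t ((x, y, z) - s) := by
  simp only [youngWalks, Set.mem_ofPred_eq, partialSum3_snoc_last, Fin.forall_fin_succ',
    Fin.snoc_castSucc, Fin.snoc_last, eq_sub_iff_add_eq]
  constructor
  · rintro ⟨⟨hf, hs⟩, hr, hp⟩
    refine ⟨hs, hf, fun r h => ?_, hp⟩
    simpa only [partialSum3_snoc_of_le f s h] using hr r (by omega)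
  · rintro ⟨hs, hf, hr, hp⟩
    refine ⟨⟨hf, hs⟩, fun r h => ?_, hp⟩
    rcases Nat.le_succ_iff.mp h with h | rfl
    · simpa only [partialSum3_snoc_of_le f s h] using hr r h
    · rw [Nat.succ_eq_add_one, partialSum3_snoc_last, hp]
      exact ⟨hxy, hzx⟩

theorem youngWalks_succ {t : ℕ} {x y z : ℤ} (hxy : x ≤ y) (hzx : z ≤ x) :
    youngWalks (t + 1) (x, y, z) =
      (fun f => (Fin.snoc f (1, 0, 0) : Fin (t + 1) → ℤ × ℤ × ℤ)) '' youngWalks t (x - 1, y, z) ∪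
      ((fun f => (Fin.snoc f (0, 1, 0) : Fin (t + 1) → ℤ × ℤ × ℤ)) '' youngWalks t (x, y - 1, z) ∪
      (fun f => (Fin.snoc f (0, 0, 1) : Fin (t + 1) → ℤ × ℤ × ℤ)) ''
        youngWalks t (x, y, z - 1)) := by
  ext f
  induction f using Fin.snocCases with
  | snoc f s =>
    rw [snoc_mem_youngWalks_iff hxy hzx]
    simp only [Set.mem_insert_iff, Set.mem_singleton_iff, Set.mem_union, Set.mem_image,
      Fin.snoc_inj]
    constructor
    · rintro ⟨rfl | rfl | rfl, hf⟩ <;> simp at hf <;> simp [hf]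
    · rintro (⟨g, hg, rfl, rfl⟩ | ⟨g, hg, rfl, rfl⟩ | ⟨g, hg, rfl, rfl⟩) <;> simp [hg]

theorem youngWalks_eq_empty {t : ℕ} {x y z : ℤ} (h : ¬ (x ≤ y ∧ z ≤ x)) :
    youngWalks t (x, y, z) = ∅ := by
  refine Set.eq_empty_of_forall_notMem fun f hf => h ?_
  have := hf.2.1 t le_rfl
  rwa [hf.2.2] at this

theorem youngWalks_finite (t : ℕ) (x y z : ℤ) : (youngWalks t (x, y, z)).Finite := by
  induction t generalizing x y z with
  | zero => exact Set.toFinite _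
  | succ t ih =>
    by_cases h : x ≤ y ∧ z ≤ x
    · rw [youngWalks_succ h.1 h.2]
      exact ((ih _ _ _).image _).union (((ih _ _ _).image _).union ((ih _ _ _).image _))
    · simp [youngWalks_eq_empty h]

theorem ncard_youngWalks_succ {t : ℕ} {x y z : ℤ} (hxy : x ≤ y) (hzx : z ≤ x) :
    (youngWalks (t + 1) (x, y, z)).ncard = (youngWalks t (x - 1, y, z)).ncard +
      ((youngWalks t (x, y - 1, z)).ncard + (youngWalks t (x, y, z - 1)).ncard) := by
  have hinj (s : ℤ × ℤ × ℤ) :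
      Function.Injective fun f : Fin t → ℤ × ℤ × ℤ => (Fin.snoc f s : Fin (t + 1) → ℤ × ℤ × ℤ) :=
    fun f g h => (Fin.snoc_inj.mp h).1
  have hfin (s : ℤ × ℤ × ℤ) (x y z : ℤ) := (youngWalks_finite t x y z).image
    fun f => (Fin.snoc f s : Fin (t + 1) → ℤ × ℤ × ℤ)
  rw [youngWalks_succ hxy hzx, Set.ncard_union_eq _ (hfin _ _ _ _)
    ((hfin _ _ _ _).union (hfin _ _ _ _)), Set.ncard_union_eq _ (hfin _ _ _ _) (hfin _ _ _ _),
    Set.ncard_image_of_injective _ (hinj _), Set.ncard_image_of_injective _ (hinj _),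
    Set.ncard_image_of_injective _ (hinj _)]
  · rw [Set.disjoint_left]
    rintro _ ⟨f, -, rfl⟩ ⟨g, -, h⟩
    simp [Fin.snoc_inj] at h
  · rw [Set.disjoint_left]
    rintro _ ⟨f, -, rfl⟩ (⟨g, -, h⟩ | ⟨g, -, h⟩) <;> simp [Fin.snoc_inj] at h

/-- The reciprocal factorial of an integer, which is zero at negative integers. -/
def intInvFactorial (m : ℤ) : ℚ := if m < 0 then 0 else ((m.toNat.factorial : ℕ) : ℚ)⁻¹

theorem intInvFactorial_natCast (m : ℕ) : intInvFactorial m = ((m.factorial : ℕ) : ℚ)⁻¹ := by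
  simp [intInvFactorial]

theorem intInvFactorial_sub_one (m : ℤ) : intInvFactorial (m - 1) = m * intInvFactorial m := by
  rcases lt_or_ge m 0 with h | h
  · simp [intInvFactorial, h, show m - 1 < 0 by omega]
  · lift m to ℕ using h
    cases m with
    | zero => simp [intInvFactorial]
    | succ m =>
      rw [show ((m + 1 : ℕ) : ℤ) - 1 = (m : ℤ) by push_cast; ring, intInvFactorial_natCast,
        intInvFactorial_natCast, Nat.factorial_succ]
      have := m.factorial_ne_zero
      push_cast
      field_simp

theorem ncard_youngWalks {t : ℕ} {x y z : ℤ} (hsum : x + y + z = t) (hxy : x ≤ y + 1)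
    (hzx : z ≤ x + 1) :
    ((youngWalks t (x, y, z)).ncard : ℚ) =
      t.factorial * ((y - x + 1) * (y - z + 2) * (x - z + 1)) *
        (intInvFactorial (y + 2) * intInvFactorial (x + 1) * intInvFactorial z) := by
  by_cases h : x ≤ y ∧ z ≤ x
  · obtain ⟨hxy, hzx⟩ := h
    induction t generalizing x y z with
    | zero =>
      rcases lt_or_ge z 0 with hz | hz
      · have : youngWalks 0 (x, y, z) = ∅ := by
          refine Set.eq_empty_of_forall_notMem fun f hf => ?_
          have := hf.2.2
          simp [partialSum3, Prod.ext_iff] at this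
          omega
        simp [this, intInvFactorial, hz]
      · obtain rfl : z = 0 := by simp at hsum; omega
        obtain rfl : x = 0 := by simp at hsum; omega
        obtain rfl : y = 0 := by simp at hsum; omega
        have : youngWalks 0 (0, 0, 0) = Set.univ := by
          ext f
          simp [youngWalks, partialSum3, Prod.ext_iff]
        simp [this, intInvFactorial]
    | succ t ih =>
      have key {x y z : ℤ} (hsum : x + y + z = t) (hxy : x ≤ y + 1) (hzx : z ≤ x + 1) :
          ((youngWalks t (x, y, z)).ncard : ℚ) =
            t.factorial * ((y - x + 1) * (y - z + 2) * (x - z + 1)) *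
              (intInvFactorial (y + 2) * intInvFactorial (x + 1) * intInvFactorial z) := by
        by_cases h : x ≤ y ∧ z ≤ x
        · exact ih hsum hxy hzx h.1 h.2
        · rw [youngWalks_eq_empty h]
          obtain rfl | rfl : x = y + 1 ∨ z = x + 1 := by omega
          · simp
          · simp
      push_cast at hsum
      rw [ncard_youngWalks_succ hxy hzx]
      push_cast
      rw [key (by omega) (by omega) (by omega), key (by omega) (by omega) (by omega),
        key (by omega) (by omega) (by omega), intInvFactorial_sub_one z,
        show x - 1 + 1 = x + 1 - 1 by ring, intInvFactorial_sub_one (x + 1),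
        show y - 1 + 2 = y + 2 - 1 by ring, intInvFactorial_sub_one (y + 2),
        Nat.factorial_succ]
      have ht : (t : ℚ) = x + y + z - 1 := by
        rw [eq_sub_iff_add_eq]
        exact_mod_cast hsum.symm
      push_cast
      rw [ht]
      ring
  · rw [youngWalks_eq_empty h]
    obtain rfl | rfl : x = y + 1 ∨ z = x + 1 := by omega
    · simp
    · simp

/-- The number of lattice walks from `(0,0,0)` to `(n,n,n)` of length `3n` using the unit
steps `(1,0,0)`, `(0,1,0)`, `(0,0,1)`, all of whose positions `(x,y,z)` satisfy
`y ≥ x ≥ z`, equals the `n`-th 3D Catalan number `2·(3n)!/((n+2)!(n+1)!n!)`. -/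
theorem young_walk_count_eq_3d_catalan (n : ℕ) :
    Nat.card {f : Fin (3 * n) → ℤ × ℤ × ℤ //
      (∀ i, f i ∈ ({((1 : ℤ), (0 : ℤ), (0 : ℤ)), ((0 : ℤ), (1 : ℤ), (0 : ℤ)),
          ((0 : ℤ), (0 : ℤ), (1 : ℤ))} : Set (ℤ × ℤ × ℤ))) ∧
      (∀ r ≤ 3 * n, (partialSum3 f r).1 ≤ (partialSum3 f r).2.1 ∧
        (partialSum3 f r).2.2 ≤ (partialSum3 f r).1) ∧
      partialSum3 f (3 * n) = ((n : ℤ), (n : ℤ), (n : ℤ))} =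
    2 * Nat.factorial (3 * n) /
      (Nat.factorial (n + 2) * Nat.factorial (n + 1) * Nat.factorial n) := by
  change (youngWalks (3 * n) (n, n, n)).ncard = _
  have h := ncard_youngWalks (t := 3 * n) (x := n) (y := n) (z := n) (by push_cast; ring)
    (by omega) (by omega)
  rw [show (n : ℤ) + 2 = ((n + 2 : ℕ) : ℤ) by norm_cast,
    show (n : ℤ) + 1 = ((n + 1 : ℕ) : ℤ) by norm_cast, intInvFactorial_natCast,
    intInvFactorial_natCast, intInvFactorial_natCast] at h
  have h₂ := (n + 2).factorial_ne_zero
  have h₁ := (n + 1).factorial_ne_zero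
  have h₀ := n.factorial_ne_zero
  refine (Nat.div_eq_of_eq_mul_left (by positivity) ?_).symm
  rw [← Nat.cast_inj (R := ℚ)]
  push_cast
  rw [h]
  field_simp
  ring
end

section
/- Let A be a nonempty set of integers, each at least 2, and let b = gcd({k/2 : k ∈ A, k even} ∪ {k : k ∈ A, k odd}). Suppose c_e ≥ 0 and (c_k)_{k∈A} are nonnegative integers, only finitely many nonzero, satisfying 2·c_e = Σ_{k∈A} (k−2)·c_k. Then b divides c_e + Σ_{k∈A} c_k. -/
/-- The set `{k/2 : k ∈ A, k even} ∪ {k : k ∈ A, k odd}` associated to a set `A` of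
allowed face sizes. -/
def halfOddSet (A : Set ℕ) : Set ℕ :=
  {q | (∃ k ∈ A, Even k ∧ k = 2 * q) ∨ (∃ k ∈ A, Odd k ∧ k = q)}

/-- `b` is the greatest common divisor of the (possibly infinite) set `B ⊆ ℕ`:
it divides every element, and every common divisor of `B` divides it. -/
def IsGcdOfSet (b : ℕ) (B : Set ℕ) : Prop :=
  (∀ x ∈ B, b ∣ x) ∧ ∀ d : ℕ, (∀ x ∈ B, d ∣ x) → d ∣ b

/-- The bipolar step set `S_A = {(1,-1)} ∪ {(-i,j) : i,j ≥ 0, i+j+2 ∈ A} ⊆ ℤ²`. -/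
def bipolarSteps (A : Set ℕ) : Set (ℤ × ℤ) :=
  {p | p = (1, -1) ∨ ∃ i j : ℕ, i + j + 2 ∈ A ∧ p = (-(i : ℤ), (j : ℤ))}

/-- If nonnegative integers `c_e` and `(c_k)_{k ∈ A}` (finitely many nonzero) satisfy the
balance condition `2·c_e = Σ_{k ∈ A} (k-2)·c_k`, then `b = gcd({k/2 : k ∈ A even} ∪
{k : k ∈ A odd})` divides the total number of moves `c_e + Σ_k c_k`. -/
theorem gcd_dvd_total_moves
    (A : Set ℕ) (hA : A.Nonempty) (hA2 : ∀ k ∈ A, 2 ≤ k)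
    (b : ℕ) (hb : IsGcdOfSet b (halfOddSet A))
    (ce : ℕ) (c : ℕ →₀ ℕ) (hsupp : ∀ k, c k ≠ 0 → k ∈ A)
    (hbal : 2 * ce = ∑ k ∈ c.support, (k - 2) * c k) :
    b ∣ ce + ∑ k ∈ c.support, c k := by
  have htotal : 2 * (ce + ∑ k ∈ c.support, c k) = ∑ k ∈ c.support, k * c k := by
    rw [mul_add, hbal, Finset.mul_sum, ← Finset.sum_add_distrib]
    refine Finset.sum_congr rfl fun k hk => ?_
    rw [← add_mul, Nat.sub_add_cancel (hA2 k (hsupp k (Finsupp.mem_support_iff.mp hk)))]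
  have hodd : ∀ k ∈ A, Odd k → b ∣ k := fun k hk ho => hb.1 k (Or.inr ⟨k, hk, ho, rfl⟩)
  have heven : ∀ k ∈ A, Even k → 2 * b ∣ k := by
    intro k hk he
    obtain ⟨q, rfl⟩ := he.two_dvd
    exact mul_dvd_mul_left 2 (hb.1 q (Or.inl ⟨2 * q, hk, he, rfl⟩))
  by_cases h : ∃ k ∈ A, Odd k
  · obtain ⟨m, hm, hmo⟩ := h
    have hb_odd : Odd b := hmo.of_dvd_nat (hodd m hm hmo)
    refine (Nat.coprime_two_right.mpr hb_odd).dvd_of_dvd_mul_left ?_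
    rw [htotal]
    refine Finset.dvd_sum fun k hk => Dvd.dvd.mul_right ?_ _
    have hkA := hsupp k (Finsupp.mem_support_iff.mp hk)
    rcases Nat.even_or_odd k with he | ho
    · exact (dvd_mul_left b 2).trans (heven k hkA he)
    · exact hodd k hkA ho
  · push Not at h
    refine Nat.dvd_of_mul_dvd_mul_left two_pos ?_
    rw [htotal]
    refine Finset.dvd_sum fun k hk => Dvd.dvd.mul_right ?_ _
    have hkA := hsupp k (Finsupp.mem_support_iff.mp hk)
    exact heven k hkA (Nat.not_odd_iff_even.mp (h k hkA))
end

section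
/- Let A be a nonempty set of integers, each at least 2, let S_A = {(1,−1)} ∪ {(−i,j) : i ≥ 0, j ≥ 0, i+j+2 ∈ A} ⊆ ℤ², and let b = gcd({k/2 : k ∈ A, k even} ∪ {k : k ∈ A, k odd}). Then the set T = {t ≥ 1 : there exists a sequence of t steps from S_A whose total sum is (0,0)} is nonempty, and the greatest common divisor of T equals b. In other words, the period of the walk on ℤ² with steps in S_A is exactly b. -/
/-- A common divisor of the face sizes divides `2 * t - (x - y)` for every walk of length `t`
with total displacement `(x, y)`. -/
theorem dvd_two_mul_length_sub (A : Set ℕ) (c : ℕ) (hc : ∀ k ∈ A, c ∣ k)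
    (l : List (ℤ × ℤ)) (hl : ∀ p ∈ l, p ∈ bipolarSteps A) :
    (c : ℤ) ∣ 2 * (l.length : ℤ) - (l.sum.1 - l.sum.2) := by
  induction l with
  | nil => simp
  | cons p l ih =>
    have hrest := ih fun q hq => hl q (List.mem_cons_of_mem _ hq)
    have hp : (c : ℤ) ∣ 2 - (p.1 - p.2) := by
      rcases hl p List.mem_cons_self with rfl | ⟨i, j, hij, rfl⟩
      · simp
      · have h : (c : ℤ) ∣ ((i + j + 2 : ℕ) : ℤ) := Int.natCast_dvd_natCast.mpr (hc _ hij)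
        convert h using 1
        push_cast
        ring
    have hsplit : 2 * ((p :: l).length : ℤ) - ((p :: l).sum.1 - (p :: l).sum.2) =
        (2 - (p.1 - p.2)) + (2 * (l.length : ℤ) - (l.sum.1 - l.sum.2)) := by
      rw [List.length_cons, List.sum_cons, Prod.fst_add, Prod.snd_add]
      push_cast
      ring
    rw [hsplit]
    exact dvd_add hp hrest

/-- A common divisor of `halfOddSet A` divides the length of every closed walk. -/
theorem dvd_length_of_sum_eq_zero (A : Set ℕ) (b : ℕ) (hb : ∀ q ∈ halfOddSet A, b ∣ q)
    (l : List (ℤ × ℤ)) (hl : ∀ p ∈ l, p ∈ bipolarSteps A) (hsum : l.sum = (0, 0)) :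
    b ∣ l.length := by
  have key : ∀ c : ℕ, (∀ k ∈ A, c ∣ k) → c ∣ 2 * l.length := fun c hc => by
    have h := dvd_two_mul_length_sub A c hc l hl
    rw [hsum, sub_self, sub_zero] at h
    exact_mod_cast h
  rcases Nat.even_or_odd b with hbe | hbo
  · refine Nat.dvd_of_mul_dvd_mul_left two_pos (key (2 * b) fun k hk => ?_)
    rcases Nat.even_or_odd' k with ⟨q, rfl | rfl⟩
    · exact mul_dvd_mul_left 2 (hb q (Or.inl ⟨_, hk, even_two_mul q, rfl⟩))
    · have h : 2 ∣ 2 * q + 1 :=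
        hbe.two_dvd.trans (hb _ (Or.inr ⟨_, hk, odd_two_mul_add_one q, rfl⟩))
      omega
  · refine (Nat.Coprime.dvd_mul_left hbo.coprime_two_right).mp (key b fun k hk => ?_)
    rcases Nat.even_or_odd' k with ⟨q, rfl | rfl⟩
    · exact (hb q (Or.inl ⟨_, hk, even_two_mul q, rfl⟩)).mul_left 2
    · exact hb _ (Or.inr ⟨_, hk, odd_two_mul_add_one q, rfl⟩)

/-- Every element of `halfOddSet A` is the length of a closed walk. -/
theorem exists_closed_walk_of_mem_halfOddSet (A : Set ℕ) (hA2 : ∀ k ∈ A, 2 ≤ k)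
    (q : ℕ) (hq : q ∈ halfOddSet A) :
    1 ≤ q ∧ ∃ l : List (ℤ × ℤ), (∀ p ∈ l, p ∈ bipolarSteps A) ∧
      l.length = q ∧ l.sum = (0, 0) := by
  rcases hq with ⟨k, hk, -, rfl⟩ | ⟨k, hk, hodd, rfl⟩
  · obtain ⟨m, rfl⟩ : ∃ m, q = m + 1 := ⟨q - 1, by have := hA2 _ hk; omega⟩
    refine ⟨by omega, (-(m : ℤ), (m : ℤ)) :: List.replicate m (1, -1), ?_, by simp, by simp⟩
    simp only [List.mem_cons, List.mem_replicate]
    rintro p (rfl | ⟨-, rfl⟩)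
    · exact Or.inr ⟨m, m, by convert hk using 1; ring, rfl⟩
    · exact Or.inl rfl
  · obtain ⟨m, rfl⟩ : ∃ m, k = m + 2 := ⟨k - 2, by have := hA2 _ hk; omega⟩
    refine ⟨by omega, (-(m : ℤ), 0) :: (0, (m : ℤ)) :: List.replicate m (1, -1), ?_,
      by simp, by simp⟩
    simp only [List.mem_cons, List.mem_replicate]
    rintro p (rfl | rfl | ⟨-, rfl⟩)
    · exact Or.inr ⟨m, 0, hk, by simp⟩
    · exact Or.inr ⟨0, m, by simpa using hk, by simp⟩
    · exact Or.inl rfl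

/-- A nonempty set of face sizes has nonempty `halfOddSet`. -/
theorem halfOddSet_nonempty (A : Set ℕ) (hA : A.Nonempty) : (halfOddSet A).Nonempty := by
  obtain ⟨k, hk⟩ := hA
  rcases Nat.even_or_odd' k with ⟨q, rfl | rfl⟩
  · exact ⟨q, Or.inl ⟨_, hk, even_two_mul q, rfl⟩⟩
  · exact ⟨_, Or.inr ⟨_, hk, odd_two_mul_add_one q, rfl⟩⟩

/-- The set `T` of lengths `t ≥ 1` of closed walks with steps in `S_A` is nonempty, and
its greatest common divisor is exactly `b = gcd({k/2 : k ∈ A even} ∪ {k : k ∈ A odd})`: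
the period of the walk with steps in `S_A` is `b`. -/
theorem period_of_bipolar_walk
    (A : Set ℕ) (hA : A.Nonempty) (hA2 : ∀ k ∈ A, 2 ≤ k)
    (b : ℕ) (hb : IsGcdOfSet b (halfOddSet A)) :
    {t : ℕ | 1 ≤ t ∧ ∃ l : List (ℤ × ℤ), (∀ p ∈ l, p ∈ bipolarSteps A) ∧
        l.length = t ∧ l.sum = (0, 0)}.Nonempty ∧
    IsGcdOfSet b {t : ℕ | 1 ≤ t ∧ ∃ l : List (ℤ × ℤ), (∀ p ∈ l, p ∈ bipolarSteps A) ∧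
        l.length = t ∧ l.sum = (0, 0)} := by
  refine ⟨(halfOddSet_nonempty A hA).mono (exists_closed_walk_of_mem_halfOddSet A hA2), ?_, ?_⟩
  · rintro t ⟨-, l, hl, rfl, hsum⟩
    exact dvd_length_of_sum_eq_zero A b hb.1 l hl hsum
  · exact fun d hd => hb.2 d fun q hq => hd q (exists_closed_walk_of_mem_halfOddSet A hA2 q hq)
end

section
/- Let A be a nonempty set of integers, each at least 2, let S_A = {(1,−1)} ∪ {(−i,j) : i ≥ 0, j ≥ 0, i+j+2 ∈ A} ⊆ ℤ², and let b = gcd({k/2 : k ∈ A, k even} ∪ {k : k ∈ A, k odd}). If m, n ≥ 0 and there exists a sequence of t steps from S_A whose total sum is (n, −m) (i.e., a walk in ℤ² from (0,m) to (n,0) of length t), then 2t ≡ m + n (mod b). -/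
theorem IsGcdOfSet.dvd_of_mem {A : Set ℕ} {b : ℕ} (hb : IsGcdOfSet b (halfOddSet A))
    {k : ℕ} (hk : k ∈ A) : b ∣ k := by
  rcases Nat.even_or_odd' k with ⟨q, h | h⟩
  · exact h ▸ (hb.1 q (Or.inl ⟨k, hk, h ▸ even_two_mul q, h⟩)).mul_left 2
  · exact hb.1 k (Or.inr ⟨k, hk, ⟨q, h⟩, rfl⟩)

theorem dvd_two_sub_of_mem_bipolarSteps {A : Set ℕ} {b : ℕ} (hb : ∀ k ∈ A, b ∣ k)
    {p : ℤ × ℤ} (hp : p ∈ bipolarSteps A) : (b : ℤ) ∣ 2 - (p.1 - p.2) := by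
  rcases hp with rfl | ⟨i, j, hij, rfl⟩
  · norm_num
  · have h : (b : ℤ) ∣ ((i + j + 2 : ℕ) : ℤ) := Int.natCast_dvd_natCast.mpr (hb _ hij)
    convert h using 1
    push_cast
    ring

theorem dvd_two_mul_length_sub_of_forall_mem_bipolarSteps {A : Set ℕ} {b : ℕ}
    (hb : ∀ k ∈ A, b ∣ k) (l : List (ℤ × ℤ)) (hl : ∀ p ∈ l, p ∈ bipolarSteps A) :
    (b : ℤ) ∣ 2 * l.length - (l.sum.1 - l.sum.2) := by
  induction l with
  | nil => simp
  | cons p l ih =>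
    rw [List.forall_mem_cons] at hl
    have h := dvd_add (dvd_two_sub_of_mem_bipolarSteps hb hl.1) (ih hl.2)
    rw [List.length_cons, List.sum_cons, Prod.fst_add, Prod.snd_add]
    refine h.trans (dvd_of_eq ?_)
    push_cast
    ring

/-- If there is a walk of length `t` with steps in `S_A` from `(0,m)` to `(n,0)` (i.e.
with total sum `(n,-m)`), then `2t ≡ m + n (mod b)` where
`b = gcd({k/2 : k ∈ A even} ∪ {k : k ∈ A odd})`. -/
theorem walk_length_congruence
    (A : Set ℕ) (hA : A.Nonempty) (hA2 : ∀ k ∈ A, 2 ≤ k)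
    (b : ℕ) (hb : IsGcdOfSet b (halfOddSet A))
    (m n t : ℕ) (l : List (ℤ × ℤ)) (hl : ∀ p ∈ l, p ∈ bipolarSteps A)
    (hlen : l.length = t) (hsum : l.sum = ((n : ℤ), -(m : ℤ))) :
    2 * t ≡ m + n [MOD b] := by
  have h := dvd_two_mul_length_sub_of_forall_mem_bipolarSteps
    (fun _ hk => hb.dvd_of_mem hk) l hl
  rw [hsum, hlen] at h
  refine (Nat.modEq_iff_dvd.mpr ?_).symm
  convert h using 1
  push_cast
  ring
end

section
/- Let A be a set of integers, each at least 2, containing some k ≥ 3, and let S_A = {(1,−1)} ∪ {(−i,j) : i ≥ 0, j ≥ 0, i+j+2 ∈ A} ⊆ ℤ². Fix m, n ≥ 0, and assume either m + n is even or A contains an odd element. Then for every R > 0 there exists a finite sequence of steps from S_A starting at (0,m), all of whose partial-sum positions lie in ℤ_{≥0}², ending at (n,0), and passing through at least one position both of whose coordinates are at least R. -/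
/-- `q` is reached from `p` by a single bipolar step; being pairs of natural numbers, both
points lie in the quadrant. -/
def QuadrantStep (A : Set ℕ) (p q : ℕ × ℕ) : Prop :=
  ((q.1 : ℤ) - p.1, (q.2 : ℤ) - p.2) ∈ bipolarSteps A

/-- `q` is reached from `p` by a walk of bipolar steps staying in the quadrant. -/
def QuadrantReachable (A : Set ℕ) : ℕ × ℕ → ℕ × ℕ → Prop :=
  Relation.ReflTransGen (QuadrantStep A)

namespace QuadrantReachable

variable {A : Set ℕ}

theorem exists_list {p q : ℕ × ℕ} (h : QuadrantReachable A p q) :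
    ∃ l : List (ℤ × ℤ), (∀ s ∈ l, s ∈ bipolarSteps A) ∧
      (∀ r, 0 ≤ (((p.1 : ℤ), (p.2 : ℤ)) + (l.take r).sum).1 ∧
        0 ≤ (((p.1 : ℤ), (p.2 : ℤ)) + (l.take r).sum).2) ∧
      ((p.1 : ℤ), (p.2 : ℤ)) + l.sum = ((q.1 : ℤ), (q.2 : ℤ)) := by
  induction h using Relation.ReflTransGen.head_induction_on with
  | refl => exact ⟨[], by simp⟩
  | @head a b hab _ ih =>
    obtain ⟨l, hl, hpos, hsum⟩ := ih
    have hb : ((a.1 : ℤ), (a.2 : ℤ)) + ((b.1 : ℤ) - a.1, (b.2 : ℤ) - a.2) =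
        ((b.1 : ℤ), (b.2 : ℤ)) := by simp
    refine ⟨((b.1 : ℤ) - a.1, (b.2 : ℤ) - a.2) :: l, ?_, ?_, ?_⟩
    · rintro s hs
      rcases List.mem_cons.1 hs with rfl | hs
      · exact hab
      · exact hl s hs
    · rintro (_ | r)
      · simp
      · rw [List.take_succ_cons, List.sum_cons, ← add_assoc, hb]
        exact hpos r
    · rw [List.sum_cons, ← add_assoc, hb, hsum]

theorem diagonal_step (x y : ℕ) : QuadrantReachable A (x, y + 1) (x + 1, y) :=
  .single (Or.inl (by simp))

theorem face_step {i j : ℕ} (h : i + j + 2 ∈ A) (x y : ℕ) :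
    QuadrantReachable A (x + i, y) (x, y + j) :=
  .single (Or.inr ⟨i, j, h, by simp⟩)

theorem diagonal_steps (x y t : ℕ) : QuadrantReachable A (x, y + t) (x + t, y) := by
  induction t generalizing x with
  | zero => exact .refl
  | succ t ih =>
    refine (diagonal_step x (y + t)).trans ?_
    have := ih (x + 1)
    rwa [add_assoc, add_comm 1 t] at this

theorem reverse_diagonal_step {d : ℕ} (hd : d + 3 ∈ A) (x y : ℕ) :
    QuadrantReachable A (x + 1, y) (x, y + 1) := by
  have h₁ : QuadrantReachable A (x + 1, y) (x + 1, y + (d + 1)) :=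
    face_step (i := 0) (by convert hd using 1; omega) (x + 1) y
  have h₂ : QuadrantReachable A (x + 1, y + 1 + d) (x + 1 + d, y + 1) := diagonal_steps _ _ _
  have h₃ : QuadrantReachable A (x + (d + 1), y + 1) (x, y + 1) :=
    face_step (j := 0) (by convert hd using 1) x (y + 1)
  rw [show y + (d + 1) = y + 1 + d by omega] at h₁
  rw [show x + (d + 1) = x + 1 + d by omega] at h₃
  exact (h₁.trans h₂).trans h₃

theorem reverse_diagonal_steps {d : ℕ} (hd : d + 3 ∈ A) (x y t : ℕ) :
    QuadrantReachable A (x + t, y) (x, y + t) := by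
  induction t generalizing y with
  | zero => exact .refl
  | succ t ih =>
    refine (reverse_diagonal_step hd (x + t) y).trans ?_
    have := ih (y + 1)
    rwa [add_assoc, add_comm 1 t] at this

theorem of_add_eq {d : ℕ} (hd : d + 3 ∈ A) {p q : ℕ × ℕ} (h : p.1 + p.2 = q.1 + q.2) :
    QuadrantReachable A p q := by
  obtain ⟨a, b⟩ := p
  obtain ⟨a', b'⟩ := q
  simp only at h
  rcases le_total a a' with hle | hle
  · obtain ⟨t, rfl⟩ := Nat.exists_eq_add_of_le hle
    obtain rfl : b = b' + t := by omega
    exact diagonal_steps _ _ _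
  · obtain ⟨t, rfl⟩ := Nat.exists_eq_add_of_le hle
    obtain rfl : b' = b + t := by omega
    exact reverse_diagonal_steps hd _ _ _

/-- A face step, up to moves along antidiagonals. -/
theorem of_face {d : ℕ} (hd : d + 3 ∈ A) {i j : ℕ} (h : i + j + 2 ∈ A) {p q : ℕ × ℕ}
    (hi : i ≤ p.1 + p.2) (hpq : p.1 + p.2 + j = q.1 + q.2 + i) : QuadrantReachable A p q := by
  have hface := face_step h (p.1 + p.2 - i) 0
  refine ((of_add_eq hd ?_).trans hface).trans (of_add_eq hd ?_)
  · simp only; omega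
  · simp only; omega

theorem symm {d : ℕ} (hd : d + 3 ∈ A) {p q : ℕ × ℕ} (h : QuadrantReachable A p q) :
    QuadrantReachable A q p := by
  induction h with
  | refl => exact .refl
  | @tail b c _ hbc ih =>
    refine Relation.ReflTransGen.trans ?_ ih
    rcases hbc with heq | ⟨i, j, hij, heq⟩
    · rw [Prod.mk.injEq] at heq
      exact of_add_eq hd (by omega)
    · rw [Prod.mk.injEq] at heq
      exact of_face hd (i := j) (j := i) (by rwa [add_comm j i]) (by omega) (by omega)

theorem add_mul {d : ℕ} (hd : d + 3 ∈ A) {p q : ℕ × ℕ} (N : ℕ)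
    (h : q.1 + q.2 = p.1 + p.2 + N * (d + 1)) : QuadrantReachable A p q := by
  induction N generalizing q with
  | zero => exact of_add_eq hd (by omega)
  | succ N ih =>
    have hmid := ih (q := (0, p.1 + p.2 + N * (d + 1))) (by simp)
    refine hmid.trans (of_face hd (i := 0) (j := d + 1) ?_ ?_ ?_)
    · convert hd using 1; omega
    · omega
    · simp only; rw [h]; ring

/-- The coordinate sum can be raised in increments `g` as soon as it is large. -/
theorem add_mul_of_le {d g i : ℕ} (hd : d + 3 ∈ A) (hg : i + (i + g) + 2 ∈ A)
    {p q : ℕ × ℕ} (hp : i ≤ p.1 + p.2) (t : ℕ) (h : q.1 + q.2 = p.1 + p.2 + t * g) :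
    QuadrantReachable A p q := by
  induction t generalizing q with
  | zero => exact of_add_eq hd (by omega)
  | succ t ih =>
    have hmid := ih (q := (0, p.1 + p.2 + t * g)) (by simp)
    refine hmid.trans (of_face hd hg ?_ ?_)
    · simp only; omega
    · simp only; rw [h]; ring

theorem of_dvd {d g i : ℕ} (hd : d + 3 ∈ A) (hg : i + (i + g) + 2 ∈ A)
    {p q : ℕ × ℕ} (hle : p.1 + p.2 ≤ q.1 + q.2) (h : g ∣ q.1 + q.2 - (p.1 + p.2)) :
    QuadrantReachable A p q := by
  obtain ⟨t, ht⟩ := h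
  have hi : i ≤ i * (d + 1) := Nat.le_mul_of_pos_right i d.succ_pos
  have hp : QuadrantReachable A p (0, p.1 + p.2 + i * (d + 1)) := add_mul hd i (by simp)
  have hq : QuadrantReachable A q (0, q.1 + q.2 + i * (d + 1)) := add_mul hd i (by simp)
  refine (hp.trans (add_mul_of_le hd hg ?_ t ?_)).trans (symm hd hq)
  · simp only; omega
  · simp only; rw [mul_comm t g]; omega

theorem of_parity (hk : ∃ d, d + 3 ∈ A) {p q : ℕ × ℕ}
    (hpar : Even (p.1 + p.2 + (q.1 + q.2)) ∨ ∃ d, d + 3 ∈ A ∧ Even d) :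
    QuadrantReachable A p q := by
  obtain ⟨d, g, i, hd, hg, hdvd⟩ : ∃ d g i, d + 3 ∈ A ∧ i + (i + g) + 2 ∈ A ∧
      (g = 1 ∨ g = 2 ∧ Even (p.1 + p.2 + (q.1 + q.2))) := by
    by_cases hodd : ∃ d, d + 3 ∈ A ∧ Even d
    · obtain ⟨d, hd, i, rfl⟩ := hodd
      exact ⟨i + i, 1, i, hd, by convert hd using 1; omega, Or.inl rfl⟩
    · obtain ⟨d, hd⟩ := hk
      have hdodd : ¬ Even d := fun h => hodd ⟨d, hd, h⟩
      obtain ⟨i, rfl⟩ := Nat.not_even_iff_odd.1 hdodd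
      exact ⟨2 * i + 1, 2, i, hd, by convert hd using 1; omega,
        Or.inr ⟨rfl, hpar.resolve_right hodd⟩⟩
  have hdiff : g ∣ q.1 + q.2 - (p.1 + p.2) ∧ g ∣ p.1 + p.2 - (q.1 + q.2) := by
    rcases hdvd with rfl | ⟨rfl, c, hc⟩
    · simp
    · constructor <;> omega
  rcases le_total (p.1 + p.2) (q.1 + q.2) with hle | hle
  · exact of_dvd hd hg hle hdiff.1
  · exact symm hd (of_dvd hd hg hle hdiff.2)

end QuadrantReachable

/-- If `A` contains some `k ≥ 3` and either `m + n` is even or `A` contains an odd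
element, then for every `R > 0` there is a walk with steps in `S_A` from `(0,m)` to
`(n,0)` staying in the nonnegative quadrant and passing through a position both of whose
coordinates are at least `R`. -/
theorem quadrant_walk_exists_far_from_boundary
    (A : Set ℕ) (hA2 : ∀ k ∈ A, 2 ≤ k) (hk3 : ∃ k ∈ A, 3 ≤ k)
    (m n : ℕ) (hpar : Even (m + n) ∨ ∃ k ∈ A, Odd k) :
    ∀ R : ℤ, 0 < R →
      ∃ l : List (ℤ × ℤ), (∀ p ∈ l, p ∈ bipolarSteps A) ∧
        (∀ r ≤ l.length, 0 ≤ (((0 : ℤ), (m : ℤ)) + (l.take r).sum).1 ∧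
          0 ≤ (((0 : ℤ), (m : ℤ)) + (l.take r).sum).2) ∧
        ((0 : ℤ), (m : ℤ)) + l.sum = ((n : ℤ), (0 : ℤ)) ∧
        ∃ r ≤ l.length, R ≤ (((0 : ℤ), (m : ℤ)) + (l.take r).sum).1 ∧
          R ≤ (((0 : ℤ), (m : ℤ)) + (l.take r).sum).2 := by
  intro R hR
  obtain ⟨k, hkA, hk⟩ := hk3
  obtain ⟨d, rfl⟩ := Nat.exists_eq_add_of_le' hk
  have hpar' : Even (m + n) ∨ ∃ d, d + 3 ∈ A ∧ Even d := by
    refine hpar.imp_right fun ⟨k, hkA, c, hc⟩ => ?_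
    have := hA2 k hkA
    refine ⟨2 * (c - 1), ?_, even_two_mul _⟩
    convert hkA using 1
    omega
  lift R to ℕ using hR.le
  set N := R * (d + 1) with hN
  have hRN : R ≤ N := Nat.le_mul_of_pos_right R d.succ_pos
  have hup : QuadrantReachable A (0, m) (N, m + N) :=
    QuadrantReachable.add_mul hkA (2 * R) (by simp only [hN]; ring)
  have hdown : QuadrantReachable A (N, m + N) (n, 0) :=
    (hup.symm hkA).trans (QuadrantReachable.of_parity ⟨d, hkA⟩ (by simpa using hpar'))
  obtain ⟨l₁, hl₁, hpos₁, hsum₁⟩ := hup.exists_list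
  obtain ⟨l₂, hl₂, hpos₂, hsum₂⟩ := hdown.exists_list
  simp only [Nat.cast_zero] at hpos₁ hsum₁ hpos₂ hsum₂
  refine ⟨l₁ ++ l₂, ?_, ?_, ?_, l₁.length, ?_, ?_⟩
  · intro p hp
    exact (List.mem_append.1 hp).elim (hl₁ p) (hl₂ p)
  · intro r _
    rw [List.take_append, List.sum_append]
    rcases le_total r l₁.length with hr | hr
    · rw [Nat.sub_eq_zero_of_le hr, List.take_zero, List.sum_nil, add_zero]
      exact hpos₁ r
    · rw [List.take_of_length_le hr, ← add_assoc, hsum₁]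
      exact hpos₂ _
  · rw [List.sum_append, ← add_assoc, hsum₁, hsum₂]
  · simp
  · rw [List.take_left, hsum₁]
    constructor <;> simp only <;> omega
end

section
/- Let (a_k)_{k≥2} be nonnegative real numbers and λ > 0 a real number such that Σ_{k≥2} ((k−1)(k−2)/2)·a_k·λ^k converges and equals 1, and such that C := λ^{−2} + Σ_{k≥2} (k−1)·a_k·λ^{k−2} is finite. Define ν : ℤ² → ℝ by ν(1,−1) = λ^{−2}/C, ν(−i,j) = a_{i+j+2}·λ^{i+j}/C for all integers i, j ≥ 0, and ν(z) = 0 for all other z ∈ ℤ². Then ν is a probability mass function (Σ_{z∈ℤ²} ν(z) = 1), the function z ↦ ‖z‖·ν(z) is summable over ℤ², and the mean vanishes: Σ_{z∈ℤ²} z·ν(z) = (0,0). -/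
/-- The step distribution `ν` of the lattice walk associated to face weights `(a_k)`,
tilt `λ` and normalization `C`: `ν(1,-1) = λ⁻²/C`, `ν(-i,j) = a_{i+j+2}·λ^{i+j}/C` for
`i, j ≥ 0`, and `ν = 0` elsewhere. -/
noncomputable def bipolarStepDist (a : ℕ → ℝ) (lam C : ℝ) : ℤ × ℤ → ℝ := fun z =>
  if z = (1, -1) then lam ^ (-2 : ℤ) / C
  else if z.1 ≤ 0 ∧ 0 ≤ z.2 then
    a ((-z.1).toNat + z.2.toNat + 2) * lam ^ ((-z.1).toNat + z.2.toNat) / C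
  else 0

/-- A nonnegative double series can be summed along antidiagonals. -/
theorem hasSum_of_hasSum_antidiagonal {f : ℕ × ℕ → ℝ} (hf : ∀ p, 0 ≤ f p) {g : ℕ → ℝ} {s : ℝ}
    (hfg : ∀ n, ∑ p ∈ Finset.HasAntidiagonal.antidiagonal n, f p = g n) (hg : HasSum g s) :
    HasSum f s := by
  have hfib (n : ℕ) : HasSum (fun p : Finset.HasAntidiagonal.antidiagonal n => f p) (g n) := by
    rw [← hfg n, ← Finset.sum_coe_sort]
    exact hasSum_fintype _
  have hsum : Summable (f ∘ Finset.HasAntidiagonal.sigmaAntidiagonalEquivProd) := by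
    refine (summable_sigma_of_nonneg fun _ => hf _).2 ⟨fun n => (hfib n).summable, ?_⟩
    exact hg.summable.congr fun n => (hfib n).tsum_eq.symm
  exact (Equiv.hasSum_iff _).1 (hg.sigma_of_hasSum hfib hsum)

theorem sum_antidiagonal_snd (n : ℕ) :
    ∑ p ∈ Finset.HasAntidiagonal.antidiagonal n, (p.2 : ℝ) = (n + 1) * n / 2 := by
  induction n with
  | zero => simp
  | succ n ih =>
    rw [Finset.Nat.sum_antidiagonal_succ, ih]
    push_cast
    ring

theorem sum_antidiagonal_fst (n : ℕ) :
    ∑ p ∈ Finset.HasAntidiagonal.antidiagonal n, (p.1 : ℝ) = (n + 1) * n / 2 := by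
  rw [← sum_antidiagonal_snd, ← Finset.Nat.sum_antidiagonal_swap]
  rfl

/-- A series on `ℤ × ℤ` supported on the bipolar steps splits into the edge step `(1, -1)` and the
face steps `(-i, j)`. -/
theorem hasSum_of_bipolar_support {f : ℤ × ℤ → ℝ}
    (hf : ∀ z : ℤ × ℤ, z ≠ (1, -1) → ¬(z.1 ≤ 0 ∧ 0 ≤ z.2) → f z = 0) {s : ℝ}
    (hs : HasSum (fun p : ℕ × ℕ => f (-(p.1 : ℤ), (p.2 : ℤ))) s) :
    HasSum f (f (1, -1) + s) := by
  let e : Unit ⊕ ℕ × ℕ → ℤ × ℤ :=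
    Sum.elim (fun _ => (1, -1)) fun p => (-(p.1 : ℤ), (p.2 : ℤ))
  have he : Function.Injective e := by
    rintro (_ | ⟨i, j⟩) (_ | ⟨k, l⟩) h <;> simp [e] at h ⊢
    omega
  refine (he.hasSum_iff ?_).1 (HasSum.sum (by simpa [e] using! hasSum_unique (f ∘ e ∘ Sum.inl)) hs)
  intro z hz
  refine hf z (fun h => hz ⟨Sum.inl (), h.symm⟩) fun h => hz ⟨Sum.inr ((-z.1).toNat, z.2.toNat), ?_⟩
  ext <;> simp [e] <;> omega

theorem bipolarStepDist_edge (a : ℕ → ℝ) (lam C : ℝ) :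
    bipolarStepDist a lam C (1, -1) = lam ^ (-2 : ℤ) / C := by
  simp [bipolarStepDist]

theorem bipolarStepDist_face (a : ℕ → ℝ) (lam C : ℝ) (i j : ℕ) :
    bipolarStepDist a lam C (-(i : ℤ), (j : ℤ)) = a (i + j + 2) * lam ^ (i + j) / C := by
  have h : (-(i : ℤ), (j : ℤ)) ≠ (1, -1) := by simp
  simp [bipolarStepDist, h]

theorem bipolarStepDist_eq_zero (a : ℕ → ℝ) (lam C : ℝ) (z : ℤ × ℤ) (hz : z ≠ (1, -1))
    (hz' : ¬(z.1 ≤ 0 ∧ 0 ≤ z.2)) : bipolarStepDist a lam C z = 0 := by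
  simp only [bipolarStepDist, if_neg hz, if_neg hz']

theorem bipolarStepDist_nonneg {a : ℕ → ℝ} (ha : ∀ k, 0 ≤ a k) {lam C : ℝ} (hlam : 0 ≤ lam)
    (hC : 0 ≤ C) (z : ℤ × ℤ) : 0 ≤ bipolarStepDist a lam C z := by
  have := ha ((-z.1).toNat + z.2.toNat + 2)
  unfold bipolarStepDist
  split_ifs <;> positivity

/-- Series of the step distribution against a weight `w`, nonnegative on face steps, whose sum over
the faces of degree `k + 2` is `c k`. -/
theorem hasSum_mul_bipolarStepDist {a : ℕ → ℝ} (ha : ∀ k, 0 ≤ a k) {lam C : ℝ} (hlam : 0 ≤ lam)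
    (hC : 0 ≤ C) (w : ℤ × ℤ → ℝ) (hw : ∀ i j : ℕ, 0 ≤ w (-(i : ℤ), (j : ℤ))) {c : ℕ → ℝ}
    (hc : ∀ k : ℕ, ∑ p ∈ Finset.HasAntidiagonal.antidiagonal k, w (-(p.1 : ℤ), (p.2 : ℤ)) = c k)
    {s : ℝ}
    (hs : HasSum (fun k => c k * a (k + 2) * lam ^ k) s) :
    HasSum (fun z => w z * bipolarStepDist a lam C z)
      (w (1, -1) * (lam ^ (-2 : ℤ) / C) + s / C) := by
  rw [← bipolarStepDist_edge a]
  refine hasSum_of_bipolar_support (fun z hz hz' => ?_) ?_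
  · simp only [bipolarStepDist_eq_zero a lam C z hz hz', mul_zero]
  refine hasSum_of_hasSum_antidiagonal
    (fun p => mul_nonneg (hw _ _) (bipolarStepDist_nonneg ha hlam hC _)) (fun k => ?_)
    (hs.div_const C)
  rw [← hc, mul_assoc, mul_div_assoc, Finset.sum_mul]
  refine Finset.sum_congr rfl fun p hp => ?_
  rw [bipolarStepDist_face, Finset.HasAntidiagonal.mem_antidiagonal.1 hp]

/-- If the zero-drift condition `Σ_{k≥2} ((k-1)(k-2)/2)·a_k·λ^k = 1` holds and
`C = λ⁻² + Σ_{k≥2} (k-1)·a_k·λ^{k-2}` is finite, then `ν` is a probability mass function,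
it has a finite first moment, and its mean is `(0,0)`.
(Sums over `k ≥ 2` are written with the index shifted by `2`.) -/
theorem bipolarStepDist_prob_and_mean_zero
    (a : ℕ → ℝ) (ha : ∀ k, 0 ≤ a k) (lam : ℝ) (hlam : 0 < lam)
    (hdriftSummable : Summable (fun k : ℕ =>
      (((k : ℝ) + 1) * (k : ℝ) / 2) * a (k + 2) * lam ^ (k + 2)))
    (hdrift : ∑' k : ℕ, (((k : ℝ) + 1) * (k : ℝ) / 2) * a (k + 2) * lam ^ (k + 2) = 1)
    (C : ℝ)
    (hCsummable : Summable (fun k : ℕ => ((k : ℝ) + 1) * a (k + 2) * lam ^ k))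
    (hC : C = lam ^ (-2 : ℤ) + ∑' k : ℕ, ((k : ℝ) + 1) * a (k + 2) * lam ^ k) :
    Summable (bipolarStepDist a lam C) ∧
    (∑' z : ℤ × ℤ, bipolarStepDist a lam C z) = 1 ∧
    Summable (fun z : ℤ × ℤ => ‖z‖ * bipolarStepDist a lam C z) ∧
    ∑' z : ℤ × ℤ, bipolarStepDist a lam C z • ((z.1 : ℝ), (z.2 : ℝ)) = (0, 0) := by
  have hC0 : 0 < C := by
    have h : 0 ≤ ∑' k : ℕ, ((k : ℝ) + 1) * a (k + 2) * lam ^ k :=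
      tsum_nonneg fun k => by have := ha (k + 2); positivity
    have : 0 < lam ^ (-2 : ℤ) := by positivity
    linarith
  have hmoment : HasSum (fun k : ℕ => (((k : ℝ) + 1) * k / 2) * a (k + 2) * lam ^ k)
      (lam ^ (-2 : ℤ)) := by
    have h := (hdrift ▸ hdriftSummable.hasSum).mul_left (lam ^ (-2 : ℤ))
    rw [mul_one] at h
    refine h.congr_fun fun k => ?_
    rw [zpow_neg]
    field_simp
    ring
  have hmass : HasSum (bipolarStepDist a lam C) 1 := by
    have h := hasSum_mul_bipolarStepDist ha hlam.le hC0.le (fun _ => 1) (fun _ _ => zero_le_one)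
      (c := fun k => (k : ℝ) + 1) (by simp) hCsummable.hasSum
    rw [one_mul, ← add_div, ← hC, div_self hC0.ne'] at h
    simpa only [one_mul] using h
  have hfst : HasSum (fun z : ℤ × ℤ => (z.1 : ℝ) * bipolarStepDist a lam C z) 0 := by
    have h := hasSum_mul_bipolarStepDist ha hlam.le hC0.le (fun z => -(z.1 : ℝ)) (by simp)
      (by simpa using sum_antidiagonal_fst) hmoment
    simpa [neg_mul, neg_div] using h.neg
  have hsnd : HasSum (fun z : ℤ × ℤ => (z.2 : ℝ) * bipolarStepDist a lam C z) 0 := by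
    have h := hasSum_mul_bipolarStepDist ha hlam.le hC0.le (fun z => (z.2 : ℝ)) (by simp)
      (by simpa using sum_antidiagonal_snd) hmoment
    simpa using h
  refine ⟨hmass.summable, hmass.tsum_eq, ?_, ?_⟩
  · refine .of_nonneg_of_le (fun z => ?_) (fun z => ?_) (hfst.summable.abs.add hsnd.summable.abs)
    · exact mul_nonneg (norm_nonneg z) (bipolarStepDist_nonneg ha hlam.le hC0.le z)
    · have hz := bipolarStepDist_nonneg ha hlam.le hC0.le z
      rw [abs_mul, abs_mul, abs_of_nonneg hz, ← add_mul]
      refine mul_le_mul_of_nonneg_right ?_ hz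
      rw [Prod.norm_def, Int.norm_eq_abs, Int.norm_eq_abs]
      exact max_le_add_of_nonneg (abs_nonneg _) (abs_nonneg _)
  · refine HasSum.tsum_eq ?_
    simpa only [Prod.smul_mk, smul_eq_mul, mul_comm] using hfst.prodMk hsnd
end
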